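/- Let f : {-1,1}^n → [-1,1] and ρ = dist_{L²}(f, 𝒜) where 𝒜 is the set of affine functions. Then dist_{L²}(f, 𝒜_{[-1,1]}) ≤ 18/√(ln(1/ρ)), where 𝒜_{[-1,1]} is the set of affine functions taking values in [-1,1]. -/

import Mathlib

open Classical

/-- Expectation with respect to the uniform measure on the cube `{-1,1}^n`,
encoded as `Fin n → Bool` (`true ↦ 1`, `false ↦ -1`). -/
noncomputable def Eu (n : ℕ) (f : (Fin n → Bool) → ℝ) : ℝ := (∑ x, f x) / 2 ^ n

/-- The `L²` norm with respect to the uniform measure on the cube. -/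
noncomputable def nrm (n : ℕ) (f : (Fin n → Bool) → ℝ) : ℝ :=
  Real.sqrt (Eu n fun x => f x ^ 2)

/-- `g` is affine: `g(x) = a₀ + ∑ aᵢ xᵢ`. -/
def IsAffine (n : ℕ) (g : (Fin n → Bool) → ℝ) : Prop :=
  ∃ a₀ : ℝ, ∃ a : Fin n → ℝ,
    ∀ x, g x = a₀ + ∑ i, a i * (if x i then (1 : ℝ) else -1)

/-- `L²` distance to the set of affine functions. -/
noncomputable def distA (n : ℕ) (f : (Fin n → Bool) → ℝ) : ℝ :=
  sInf {d | ∃ g, IsAffine n g ∧ d = nrm n (fun x => f x - g x)}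

/-- `L²` distance to the set of `[-1,1]`-valued affine functions. -/
noncomputable def distA11 (n : ℕ) (f : (Fin n → Bool) → ℝ) : ℝ :=
  sInf {d | ∃ g, IsAffine n g ∧ (∀ x, g x ∈ Set.Icc (-1 : ℝ) 1) ∧
    d = nrm n (fun x => f x - g x)}


/-- Sign of a bit. -/
noncomputable def sg (b : Bool) : ℝ := if b then (1 : ℝ) else -1

lemma Eu_prod (n : ℕ) (F : Fin n → Bool → ℝ) :
    Eu n (fun x => ∏ i, F i (x i)) = ∏ i, ((F i true + F i false) / 2) := by
  unfold Eu
  rw [Finset.prod_div_distrib]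
  have h := Finset.prod_univ_sum (fun _ : Fin n => (Finset.univ : Finset Bool)) F
  simp only [Fintype.piFinset_univ] at h
  rw [← h]
  simp

lemma Eu_add (n : ℕ) (u v : (Fin n → Bool) → ℝ) :
    Eu n (fun x => u x + v x) = Eu n u + Eu n v := by
  unfold Eu; rw [Finset.sum_add_distrib, add_div]

lemma Eu_smul (n : ℕ) (c : ℝ) (u : (Fin n → Bool) → ℝ) :
    Eu n (fun x => c * u x) = c * Eu n u := by
  unfold Eu; rw [← Finset.mul_sum, mul_div_assoc]

lemma Eu_sum (n : ℕ) {ι : Type*} (s : Finset ι) (u : ι → (Fin n → Bool) → ℝ) :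
    Eu n (fun x => ∑ i ∈ s, u i x) = ∑ i ∈ s, Eu n (u i) := by
  unfold Eu; rw [Finset.sum_comm, Finset.sum_div]

lemma Eu_mono (n : ℕ) {u v : (Fin n → Bool) → ℝ} (h : ∀ x, u x ≤ v x) :
    Eu n u ≤ Eu n v := by
  unfold Eu
  exact div_le_div_of_nonneg_right (Finset.sum_le_sum fun x _ => h x) (by positivity)

lemma Eu_const (n : ℕ) (c : ℝ) : Eu n (fun _ => c) = c := by
  unfold Eu; simp

lemma Eu_cs (n : ℕ) (u v : (Fin n → Bool) → ℝ) :
    Eu n (fun x => u x * v x) ^ 2 ≤ Eu n (fun x => u x ^ 2) * Eu n (fun x => v x ^ 2) := by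
  unfold Eu
  rw [div_pow, div_mul_div_comm, ← sq]
  exact div_le_div_of_nonneg_right (Finset.sum_mul_sq_le_sq_mul_sq _ _ _) (by positivity)

lemma Eu_phi_mul (n : ℕ) (s : Fin n → ℝ) (j : Fin n) :
    Eu n (fun x => (∏ i, (1 + s i * sg (x i))) * sg (x j)) = s j := by
  have h : (fun x : Fin n → Bool => (∏ i, (1 + s i * sg (x i))) * sg (x j)) =
      fun x => ∏ i, (fun i b => (1 + s i * sg b) * (if i = j then sg b else 1)) i (x i) := by
    funext x
    rw [Finset.prod_mul_distrib]
    simp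
  rw [h, Eu_prod n (fun i b => (1 + s i * sg b) * (if i = j then sg b else 1))]
  have h2 : ∀ i, (((1 + s i * sg true) * (if i = j then sg true else 1) +
      (1 + s i * sg false) * (if i = j then sg false else 1)) / 2) = if i = j then s j else 1 := by
    intro i
    split_ifs with hij
    · subst hij; simp [sg]; ring
    · simp [sg]; ring
  simp only [h2]
  simp

lemma Eu_phi (n : ℕ) (s : Fin n → ℝ) :
    Eu n (fun x => (∏ i, (1 + s i * sg (x i)))) = 1 := by
  rw [Eu_prod n (fun i b => 1 + s i * sg b)]
  apply Finset.prod_eq_one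
  intro i _
  simp [sg]; ring

lemma Eu_phi_sq (n : ℕ) (s : Fin n → ℝ) :
    Eu n (fun x => (∏ i, (1 + s i * sg (x i))) ^ 2) = ∏ i, (1 + s i ^ 2) := by
  simp only [← Finset.prod_pow]
  rw [Eu_prod n (fun i b => (1 + s i * sg b) ^ 2)]
  apply Finset.prod_congr rfl
  intro i _
  simp [sg]; ring

lemma Eu_sg_mul (n : ℕ) (i j : Fin n) :
    Eu n (fun x => sg (x i) * sg (x j)) = if i = j then 1 else 0 := by
  split_ifs with h
  · subst h
    have : ∀ x : Fin n → Bool, sg (x i) * sg (x i) = 1 := by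
      intro x; unfold sg; split_ifs <;> norm_num
    simp only [this, Eu_const]
  · have h1 : (fun x : Fin n → Bool => sg (x i) * sg (x j)) =
        fun x => ∏ l, (fun l b => (if l = i then sg b else 1) * (if l = j then sg b else 1)) l (x l) := by
      funext x
      rw [Finset.prod_mul_distrib]
      simp
    rw [h1, Eu_prod n (fun l b => (if l = i then sg b else 1) * (if l = j then sg b else 1))]
    apply Finset.prod_eq_zero (Finset.mem_univ i)
    simp [sg, h]

lemma Eu_sg (n : ℕ) (i : Fin n) : Eu n (fun x => sg (x i)) = 0 := by
  have := Eu_phi_mul n 0 i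
  simpa using this

lemma Eu_lin_sq (n : ℕ) (c : ℝ) (b : Fin n → ℝ) :
    Eu n (fun x => (c + ∑ i, b i * sg (x i)) ^ 2) = c ^ 2 + ∑ i, b i ^ 2 := by
  have h : (fun x : Fin n → Bool => (c + ∑ i, b i * sg (x i)) ^ 2) = fun x =>
      (c ^ 2 + ∑ i, (2 * c * b i) * sg (x i)) +
        ∑ i, ∑ j, (b i * b j) * (sg (x i) * sg (x j)) := by
    funext x
    have h1 : (∑ i, b i * sg (x i)) ^ 2 = ∑ i, ∑ j, (b i * b j) * (sg (x i) * sg (x j)) := by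
      rw [sq, Finset.sum_mul_sum]
      refine Finset.sum_congr rfl fun i _ => Finset.sum_congr rfl fun j _ => by ring
    rw [← h1, add_sq, Finset.mul_sum]
    congr 2
    refine Finset.sum_congr rfl fun i _ => by ring
  rw [h, Eu_add, Eu_add, Eu_const, Eu_sum, Eu_sum]
  simp only [Eu_sum, Eu_smul, Eu_sg, Eu_sg_mul]
  simp [sq]

lemma Eu_exp (n : ℕ) (l : ℝ) (b : Fin n → ℝ) :
    Eu n (fun x => Real.exp (l * ∑ i, b i * sg (x i))) = ∏ i, Real.cosh (l * b i) := by
  have h : (fun x : Fin n → Bool => Real.exp (l * ∑ i, b i * sg (x i))) =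
      fun x => ∏ i, (fun i c => Real.exp (l * b i * sg c)) i (x i) := by
    funext x
    rw [← Real.exp_sum, Finset.mul_sum]
    congr 1
    refine Finset.sum_congr rfl fun i _ => by ring
  rw [h, Eu_prod n (fun i c => Real.exp (l * b i * sg c))]
  refine Finset.prod_congr rfl fun i _ => ?_
  rw [Real.cosh_eq]
  simp [sg]

lemma cosh_lower (x : ℝ) (hx : |x| ≤ 1) : Real.exp (x ^ 2 / 3) ≤ Real.cosh x := by
  have hu : x ^ 2 ≤ 1 := by rw [← sq_abs]; nlinarith [abs_nonneg x]
  have h0 := sq_nonneg x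
  have h1 : 1 + x ^ 2 / 2 ≤ Real.cosh x := by
    have h2 := Real.cosh_two_mul (x / 2)
    have h3 := Real.cosh_sq (x / 2)
    have h4 : (x / 2) ^ 2 ≤ Real.sinh (x / 2) ^ 2 := by
      apply sq_le_sq.mpr
      rw [Real.abs_sinh]
      exact Real.self_le_sinh_iff.mpr (abs_nonneg _)
    rw [show 2 * (x / 2) = x by ring] at h2
    nlinarith
  have h5 := Real.add_one_le_exp (-(x ^ 2 / 3))
  have h6 : Real.exp (x ^ 2 / 3) * Real.exp (-(x ^ 2 / 3)) = 1 := by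
    rw [← Real.exp_add]; simp
  have h7 := Real.exp_pos (x ^ 2 / 3)
  have h8 : Real.exp (x ^ 2 / 3) * (1 - x ^ 2 / 3) ≤ 1 := by nlinarith
  have h9 : (1 : ℝ) ≤ (1 + x ^ 2 / 2) * (1 - x ^ 2 / 3) := by nlinarith
  have h10 : 0 < 1 - x ^ 2 / 3 := by linarith
  have : Real.exp (x ^ 2 / 3) ≤ 1 + x ^ 2 / 2 := by
    by_contra hc
    push Not at hc
    nlinarith
  linarith

/-- Sum of few coefficients is almost bounded by one. -/
lemma coef_bound (n : ℕ) (f : (Fin n → Bool) → ℝ) (hf : ∀ x, f x ∈ Set.Icc (-1 : ℝ) 1)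
    (c : ℝ) (a : Fin n → ℝ) (d : ℝ) (hd : 0 ≤ d)
    (hE : Eu n (fun x => (f x - (c + ∑ i, a i * sg (x i))) ^ 2) ≤ d ^ 2)
    (J : Finset (Fin n)) (R : ℝ) (hR : 0 ≤ R) (hJ : (2 : ℝ) ^ J.card ≤ R ^ 2) :
    |c| + ∑ i ∈ J, |a i| ≤ 1 + d * R := by
  obtain ⟨e, he, hec⟩ : ∃ e : ℝ, e ^ 2 = 1 ∧ e * c = |c| := by
    rcases le_total 0 c with h | h
    · exact ⟨1, by norm_num, by rw [abs_of_nonneg h]; ring⟩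
    · exact ⟨-1, by norm_num, by rw [abs_of_nonpos h]; ring⟩
  have hs : ∀ i, ∃ s : ℝ, s ^ 2 = 1 ∧ e * s * a i = |a i| := by
    intro i
    rcases le_total 0 (a i) with h | h
    · exact ⟨e, he, by rw [abs_of_nonneg h]; linear_combination a i * he⟩
    · exact ⟨-e, by linarith [neg_sq e], by rw [abs_of_nonpos h]; linear_combination -a i * he⟩
  choose s0 hs0 hs1 using hs
  set s : Fin n → ℝ := fun i => if i ∈ J then s0 i else 0 with hsdef
  set φ : (Fin n → Bool) → ℝ := fun x => ∏ i, (1 + s i * sg (x i)) with hφ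
  have hφ0 : ∀ x, 0 ≤ φ x := by
    intro x
    apply Finset.prod_nonneg
    intro i _
    have h1 : (s i * sg (x i)) ^ 2 ≤ 1 := by
      have h2 : sg (x i) ^ 2 = 1 := by unfold sg; split_ifs <;> norm_num
      rw [mul_pow, h2]
      simp only [hsdef]
      split_ifs
      · rw [hs0]; norm_num
      · norm_num
    have := abs_le_of_sq_le_sq' (h1.trans_eq (one_pow 2).symm) zero_le_one
    linarith [this.1]
  have h1 : Eu n φ = 1 := Eu_phi n s
  have h2 : Eu n (fun x => φ x ^ 2) ≤ R ^ 2 := by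
    rw [show Eu n (fun x => φ x ^ 2) = _ from Eu_phi_sq n s]
    refine le_trans (le_of_eq ?_) hJ
    rw [← Finset.prod_const, ← Finset.prod_subset (Finset.subset_univ J)]
    · refine Finset.prod_congr rfl fun i hi => ?_
      simp only [hsdef, hi, if_true, hs0]; norm_num
    · intro i _ hi
      simp [hsdef, hi]
  have h3 : Eu n (fun x => φ x * (e * (c + ∑ i, a i * sg (x i)))) = |c| + ∑ i ∈ J, |a i| := by
    have : (fun x => φ x * (e * (c + ∑ i, a i * sg (x i)))) =
        fun x => (e * c) * φ x + ∑ i, (e * a i) * (φ x * sg (x i)) := by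
      funext x
      have : ∑ i, (e * a i) * (φ x * sg (x i)) = φ x * e * ∑ i, a i * sg (x i) := by
        rw [Finset.mul_sum]
        refine Finset.sum_congr rfl fun i _ => by ring
      rw [this]; ring
    rw [this, Eu_add, Eu_smul, h1, Eu_sum]
    simp only [Eu_smul]
    have h4 : ∀ i, Eu n (fun x => φ x * sg (x i)) = s i := fun i => Eu_phi_mul n s i
    simp only [h4]
    rw [mul_one, hec, ← Finset.sum_subset (Finset.subset_univ J)]
    · congr 1
      refine Finset.sum_congr rfl fun i hi => ?_
      simp only [hsdef, hi, if_true]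
      rw [← hs1]; ring
    · intro i _ hi
      simp [hsdef, hi]
  have h5 : Eu n (fun x => φ x * (e * f x)) ≤ 1 := by
    rw [← h1]
    apply Eu_mono
    intro x
    have h6 : (e * f x) ≤ 1 := by
      have := hf x
      rcases (sq_eq_sq_iff_eq_or_eq_neg.mp (he.trans (one_pow 2).symm)) with h | h <;> rw [h] <;> linarith [this.1, this.2]
    nlinarith [hφ0 x]
  have h7 := Eu_cs n φ (fun x => f x - (c + ∑ i, a i * sg (x i)))
  set D := Eu n (fun x => φ x * (f x - (c + ∑ i, a i * sg (x i)))) with hD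
  have h8 : D ^ 2 ≤ (d * R) ^ 2 := by
    have h9 : 0 ≤ Eu n (fun x => φ x ^ 2) := by
      rw [← Eu_const n 0]; exact Eu_mono n fun x => sq_nonneg _
    calc D ^ 2 ≤ _ := h7
      _ ≤ R ^ 2 * d ^ 2 := mul_le_mul h2 hE (by
          rw [← Eu_const n 0]; exact Eu_mono n fun x => sq_nonneg _) (sq_nonneg _)
      _ = _ := by ring
  have h10 : |c| + ∑ i ∈ J, |a i| = Eu n (fun x => φ x * (e * f x)) + (-e) * D := by
    rw [← h3, hD, ← Eu_smul, ← Eu_add]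
    congr 1
    funext x; ring
  have h11 : (-e) * D ≤ d * R := by
    have : (-e * D) ^ 2 ≤ (d * R) ^ 2 := by
      rw [mul_pow, neg_sq, he, one_mul]; exact h8
    exact (abs_le_of_sq_le_sq' this (by positivity)).2
  linarith

/-- Small coefficients have small total variance. -/
lemma tail_bound (n : ℕ) (f A : (Fin n → Bool) → ℝ) (hf : ∀ x, f x ≤ 1)
    (b : Fin n → ℝ) (hA : ∀ x, -(21 / 20) ≤ A x)
    (L τ : ℝ) (hL : 324 < L) (hE : Eu n (fun x => (f x - (A x + ∑ i, b i * sg (x i))) ^ 2)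
      ≤ (2 * Real.exp (-L)) ^ 2)
    (hb : ∀ i, |b i| ≤ τ) (hτ : τ * (L / 20) ≤ 1) (h4 : ∑ i, b i ^ 2 ≤ 4) :
    ∑ i, b i ^ 2 ≤ 200 / L := by
  by_contra hc
  push Not at hc
  set v := ∑ i, b i ^ 2 with hv
  have hL0 : 0 < L := by linarith
  have hv0 : 0 < v := lt_trans (by positivity) hc
  set l := 10 / v with hl
  have hl0 : 0 < l := by positivity
  have hlv : l * v = 10 := by rw [hl]; field_simp
  have hlL : l ≤ L / 20 := by
    rw [hl, div_le_iff₀ hv0]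
    rw [div_lt_iff₀ hL0] at hc
    nlinarith
  set T : (Fin n → Bool) → ℝ := fun x => ∑ i, b i * sg (x i) with hT
  set X : (Fin n → Bool) → ℝ := fun x => Real.exp (l * T x) with hX
  have hm : Real.exp (l ^ 2 * v / 3) ≤ Eu n X := by
    rw [show Eu n X = _ from Eu_exp n l b, hv, Finset.mul_sum, Finset.sum_div, Real.exp_sum]
    apply Finset.prod_le_prod
    · intro i _; positivity
    · intro i _
      rw [← mul_pow]
      apply cosh_lower
      rw [abs_mul, abs_of_pos hl0]
      have := abs_nonneg (b i)
      have := hb i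
      calc l * |b i| ≤ L / 20 * τ := by gcongr
        _ ≤ 1 := by linarith
  have hX2 : Eu n (fun x => X x ^ 2) ≤ Real.exp L := by
    have : (fun x => X x ^ 2) = fun x => Real.exp ((2 * l) * ∑ i, b i * sg (x i)) := by
      funext x
      rw [hX]; simp only
      rw [← Real.exp_nat_mul]; congr 1; push_cast; ring
    rw [this, Eu_exp]
    calc ∏ i, Real.cosh (2 * l * b i) ≤ ∏ i, Real.exp ((2 * l * b i) ^ 2 / 2) := by
          apply Finset.prod_le_prod
          · intro i _; positivity
          · intro i _; exact Real.cosh_le_exp_half_sq _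
      _ = Real.exp (2 * l ^ 2 * v) := by
          rw [← Real.exp_sum, hv, Finset.mul_sum]
          congr 1
          refine Finset.sum_congr rfl fun i _ => by ring
      _ ≤ Real.exp L := by
          apply Real.exp_le_exp.mpr
          nlinarith
  set m := Eu n X with hmdef
  have hm1 : 1 ≤ m := by
    refine le_trans ?_ hm
    exact Real.one_le_exp (by positivity)
  set D : (Fin n → Bool) → ℝ := fun x => |f x - (A x + ∑ i, b i * sg (x i))| with hD
  have hpt : ∀ x, X x ≤ m / 2 + X x * D x := by
    intro x
    have hXp : 0 < X x := Real.exp_pos _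
    have hDp : 0 ≤ D x := abs_nonneg _
    by_cases hx : X x ≤ m / 2
    · nlinarith [mul_nonneg hXp.le hDp]
    · push Not at hx
      have h1 : Real.exp (l ^ 2 * v / 3 - Real.log 2) < X x := by
        rw [Real.exp_sub, Real.exp_log (by norm_num)]
        linarith
      have h2 : l ^ 2 * v / 3 - Real.log 2 < l * T x := Real.exp_lt_exp.mp h1
      have h3 : Real.log 2 < 0.7 := by linarith [Real.log_two_lt_d9]
      have hl25 : 2.5 ≤ l := by
        rw [hl, le_div_iff₀ hv0]; linarith
      have h5 : (61 / 20 : ℝ) ≤ T x := by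
        by_contra hcc
        push Not at hcc
        nlinarith
      have h6 : 1 ≤ D x := by
        have := neg_abs_le (f x - (A x + ∑ i, b i * sg (x i)))
        have h7 := hf x
        have h8 := hA x
        have h9 : T x = ∑ i, b i * sg (x i) := rfl
        simp only [hD]
        linarith
      nlinarith
  have h1 : m ≤ m / 2 + Eu n (fun x => X x * D x) := by
    have := Eu_mono n hpt
    rwa [Eu_add, Eu_const] at this
  have h2 := Eu_cs n X D
  have h3 : Eu n (fun x => D x ^ 2) ≤ (2 * Real.exp (-L)) ^ 2 := by
    simpa [hD, sq_abs] using hE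
  have h5 : (1 / 4 : ℝ) ≤ Eu n (fun x => X x * D x) ^ 2 := by nlinarith
  have h6 : (1 / 4 : ℝ) ≤ Real.exp L * (2 * Real.exp (-L)) ^ 2 := by
    refine h5.trans (h2.trans ?_)
    apply mul_le_mul hX2 h3 _ (Real.exp_pos _).le
    rw [← Eu_const n 0]; exact Eu_mono n fun x => sq_nonneg _
  have h7 : Real.exp L * Real.exp (-L) = 1 := by rw [← Real.exp_add]; simp
  have h8 := Real.add_one_le_exp L
  have h9 := Real.exp_pos (-L)
  have h10 : Real.exp L * (2 * Real.exp (-L)) ^ 2 = 4 * Real.exp (-L) := by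
    linear_combination 4 * Real.exp (-L) * h7
  nlinarith

lemma pt_ineq (t u w r : ℝ) (hs : w ^ 2 ≤ 4 * r ^ 2) :
    (t + (u + w)) ^ 2 ≤ 5 / 4 * (0 + t) ^ 2 + 10 * u ^ 2 + 40 * r ^ 2 := by
  nlinarith [sq_nonneg (t - 4 * (u + w)), sq_nonneg (u - w)]

set_option maxHeartbeats 1000000 in
/-- Theorem 3: for `f : {-1,1}^n → [-1,1]` with `ρ = dist_{L²}(f,𝒜) ∈ (0,1)`,
`dist_{L²}(f, 𝒜_{[-1,1]}) ≤ 18/√(ln(1/ρ))`. -/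
theorem stmt_15 (n : ℕ) (f : (Fin n → Bool) → ℝ)
    (hf : ∀ x, f x ∈ Set.Icc (-1 : ℝ) 1)
    (hρ0 : 0 < distA n f) (hρ1 : distA n f < 1) :
    distA11 n f ≤ 18 / Real.sqrt (Real.log (1 / distA n f)) := by
  have hnn : ∀ y ∈ {d | ∃ g, IsAffine n g ∧ (∀ x, g x ∈ Set.Icc (-1 : ℝ) 1) ∧
      d = nrm n (fun x => f x - g x)}, (0 : ℝ) ≤ y := by
    rintro y ⟨g, -, -, rfl⟩
    exact Real.sqrt_nonneg _
  have key : ∀ (c : ℝ) (a : Fin n → ℝ) (K : ℝ),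
      (∀ x : Fin n → Bool, (c + ∑ i, a i * sg (x i)) ∈ Set.Icc (-1 : ℝ) 1) →
      Eu n (fun x => (f x - (c + ∑ i, a i * sg (x i))) ^ 2) ≤ K → distA11 n f ≤ Real.sqrt K := by
    intro c a K h1 h2
    refine (csInf_le ⟨0, fun y hy => hnn y hy⟩
      ⟨fun x => c + ∑ i, a i * sg (x i), ⟨c, a, fun x => rfl⟩, h1, rfl⟩).trans ?_
    exact Real.sqrt_le_sqrt h2
  set ρ := distA n f with hρ
  set L := Real.log (1 / ρ) with hLdef
  have hρL : ρ = Real.exp (-L) := by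
    rw [hLdef, one_div, Real.log_inv, neg_neg, Real.exp_log hρ0]
  have hL0 : 0 < L := Real.log_pos (by rw [lt_div_iff₀ hρ0]; linarith)
  have hgoal : 18 / Real.sqrt L = Real.sqrt (324 / L) := by
    rw [Real.sqrt_div (by norm_num), show (324 : ℝ) = 18 ^ 2 by norm_num,
      Real.sqrt_sq (by norm_num)]
  rw [hgoal]
  have hf2 : ∀ x, f x ^ 2 ≤ 1 := fun x => by nlinarith [(hf x).1, (hf x).2]
  have hEf : Eu n (fun x => f x ^ 2) ≤ 1 := by
    rw [← Eu_const n 1]; exact Eu_mono n hf2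
  rcases le_or_gt L 324 with hL | hL
  · apply key 0 0
    · intro x; simp
    · refine le_trans ?_ ((one_le_div hL0).mpr hL)
      simpa using hEf
  obtain ⟨_, ⟨g, ⟨c, a, hg⟩, rfl⟩, hlt⟩ : ∃ d ∈ {d | ∃ g, IsAffine n g ∧
      d = nrm n (fun x => f x - g x)}, d < 2 * ρ := by
    apply exists_lt_of_csInf_lt
    · exact ⟨_, fun _ => 0, ⟨0, 0, by simp⟩, rfl⟩
    · change ρ < 2 * ρ
      linarith
  have hE : Eu n (fun x => (f x - (c + ∑ i, a i * sg (x i))) ^ 2) ≤ (2 * ρ) ^ 2 := by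
    have h1 : g = fun x => (c + ∑ i, a i * sg (x i)) := funext hg
    rw [h1] at hlt
    exact ((Real.sqrt_lt' (by linarith)).mp hlt).le
  set r := Real.exp (-(L / 2)) with hr
  have hr0 : 0 < r := Real.exp_pos _
  have hρr : ρ = r ^ 2 := by
    rw [hρL, hr, ← Real.exp_nat_mul]; congr 1; push_cast; ring
  have hrL : r * (1 + L / 2) ≤ 1 := by
    have h1 := Real.add_one_le_exp (L / 2)
    have h2 : r * Real.exp (L / 2) = 1 := by rw [hr, ← Real.exp_add]; simp
    nlinarith
  have hr40 : r ≤ 1 / 100 := by nlinarith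
  set R := Real.exp (L / 2) with hR
  have hrR : r * R = 1 := by rw [hr, hR, ← Real.exp_add]; simp
  set k := ⌊L⌋₊ with hk
  have hkL : (k : ℝ) ≤ L := Nat.floor_le hL0.le
  have hkL2 : L - 1 < k := Nat.sub_one_lt_floor L
  have hk0 : (0 : ℝ) < k := by linarith
  have hcoef : ∀ J : Finset (Fin n), J.card ≤ k → |c| + ∑ i ∈ J, |a i| ≤ 1 + 2 * r := by
    intro J hJ
    have := coef_bound n f hf c a (2 * ρ) (by linarith) hE J R (Real.exp_pos _).le ?_
    · refine this.trans (le_of_eq ?_)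
      rw [hρr]; linear_combination 2 * r * hrR
    · calc (2 : ℝ) ^ J.card ≤ 2 ^ k := pow_le_pow_right₀ (by norm_num) hJ
        _ ≤ (Real.exp 1) ^ k := by
          gcongr
          linarith [Real.exp_one_gt_d9]
        _ = Real.exp k := by rw [← Real.exp_nat_mul]; simp
        _ ≤ Real.exp L := Real.exp_le_exp.mpr hkL
        _ = R ^ 2 := by rw [hR, ← Real.exp_nat_mul]; congr 1; push_cast; ring
  set I : Finset (Fin n) := Finset.univ.filter (fun i => 2 / (k : ℝ) < |a i|) with hI
  have hIk : I.card ≤ k := by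
    by_contra hcc
    push Not at hcc
    obtain ⟨J, hJI, hJc⟩ := Finset.exists_subset_card_eq hcc.le
    have h1 := hcoef J hJc.le
    have h2 : ∑ i ∈ J, (2 / (k : ℝ)) ≤ ∑ i ∈ J, |a i| := by
      apply Finset.sum_le_sum
      intro i hi
      exact (Finset.mem_filter.mp (hJI hi)).2.le
    rw [Finset.sum_const, hJc, nsmul_eq_mul, mul_div_cancel₀ _ hk0.ne'] at h2
    linarith [abs_nonneg c]
  have hM := hcoef I hIk
  set p : Fin n → ℝ := fun i => if i ∈ I then a i else 0 with hp
  set b : Fin n → ℝ := fun i => if i ∈ I then 0 else a i with hb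
  have hpb : ∀ i, a i = p i + b i := by
    intro i; simp only [hp, hb]; split_ifs <;> ring
  set A : (Fin n → Bool) → ℝ := fun x => c + ∑ i, p i * sg (x i) with hA
  have hgA : ∀ x : Fin n → Bool, c + ∑ i, a i * sg (x i) = A x + ∑ i, b i * sg (x i) := by
    intro x
    simp only [hA, hpb, add_mul, Finset.sum_add_distrib]; ring
  have hAbs : ∀ x, |A x| ≤ 1 + 2 * r := by
    intro x
    refine le_trans ?_ hM
    refine (abs_add_le _ _).trans ?_
    gcongr
    refine (Finset.abs_sum_le_sum_abs _ _).trans (le_of_eq ?_)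
    rw [← Finset.sum_subset (Finset.subset_univ I)]
    · refine Finset.sum_congr rfl fun i hi => ?_
      have : |sg (x i)| = 1 := by unfold sg; split_ifs <;> simp
      rw [abs_mul, this]; simp [hp, hi]
    · intro i _ hi; simp [hp, hi]
  have hE' := hE
  simp only [hgA] at hE'
  have hv4 : ∑ i, b i ^ 2 ≤ 4 := by
    have h1 : ∑ i, b i ^ 2 ≤ c ^ 2 + ∑ i, a i ^ 2 := by
      have : ∑ i, b i ^ 2 ≤ ∑ i, a i ^ 2 := by
        apply Finset.sum_le_sum
        intro i _
        simp only [hb]; split_ifs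
        · nlinarith [sq_nonneg (a i)]
        · exact le_rfl
      nlinarith [sq_nonneg c]
    rw [← Eu_lin_sq] at h1
    have h2 : Eu n (fun x => (c + ∑ i, a i * sg (x i)) ^ 2) ≤
        2 * Eu n (fun x => f x ^ 2) +
        2 * Eu n (fun x => (f x - (c + ∑ i, a i * sg (x i))) ^ 2) := by
      rw [← Eu_smul, ← Eu_smul, ← Eu_add]
      apply Eu_mono
      intro x
      nlinarith [sq_nonneg (2 * f x - (c + ∑ i, a i * sg (x i)))]
    have h3 : ρ ≤ 1 / 100 := by rw [hρr]; nlinarith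
    nlinarith
  have hv : ∑ i, b i ^ 2 ≤ 200 / L := by
    apply tail_bound n f A (fun x => (hf x).2) b _ L (2 / k) hL (by rw [← hρL]; exact hE') _ _ hv4
    · intro x; linarith [(abs_le.mp (hAbs x)).1]
    · intro i
      simp only [hb]; split_ifs with h
      · rw [abs_zero]; positivity
      · by_contra hcc
        exact h (Finset.mem_filter.mpr ⟨Finset.mem_univ _, not_le.mp hcc⟩)
    · rw [div_mul_eq_mul_div, div_le_one hk0]; linarith
  have hM0 : 0 < 1 + 2 * r := by linarith
  have hh : ∀ x : Fin n → Bool,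
      c / (1 + 2 * r) + ∑ i, p i / (1 + 2 * r) * sg (x i) = A x / (1 + 2 * r) := by
    intro x
    simp only [hA, add_div, Finset.sum_div]
    congr 1
    refine Finset.sum_congr rfl fun i _ => by ring
  apply key (c / (1 + 2 * r)) (fun i => p i / (1 + 2 * r))
  · intro x
    rw [hh]
    have := abs_le.mp (hAbs x)
    constructor
    · rw [le_div_iff₀ hM0]; linarith
    · rw [div_le_iff₀ hM0]; linarith
  · simp only [hh]
    have hT : Eu n (fun x => (0 + ∑ i, b i * sg (x i)) ^ 2) ≤ 200 / L := by
      rw [Eu_lin_sq]; simpa using hv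
    have h1 : Eu n (fun x => (f x - A x / (1 + 2 * r)) ^ 2) ≤
        (5 / 4 * Eu n (fun x => (0 + ∑ i, b i * sg (x i)) ^ 2) +
        10 * Eu n (fun x => (f x - (A x + ∑ i, b i * sg (x i))) ^ 2)) + 40 * r ^ 2 := by
      rw [← Eu_smul, ← Eu_smul, ← Eu_add, ← Eu_const n (40 * r ^ 2), ← Eu_add]
      apply Eu_mono
      intro x
      set t := ∑ i, b i * sg (x i)
      set q := A x / (1 + 2 * r) with hq
      have hAq : A x = q * (1 + 2 * r) := by rw [hq]; field_simp
      have hq1 : q ^ 2 ≤ 1 := by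
        have h5 : A x ^ 2 ≤ (1 + 2 * r) ^ 2 := sq_le_sq' (abs_le.mp (hAbs x)).1 (abs_le.mp (hAbs x)).2
        rw [hq, div_pow, div_le_one (by positivity)]; exact h5
      have hs : (A x - q) ^ 2 ≤ 4 * r ^ 2 := by
        rw [hAq]; nlinarith [sq_nonneg r]
      set w := A x - q
      set u := f x - (A x + t) with hu
      have : f x - q = t + (u + w) := by simp only [hu, w]; ring
      rw [this]
      exact pt_ineq t u w r hs
    have h2 : ρ * L ≤ 1 / 50 := by
      have h9 : r * L ≤ 2 := by linarith
      have h10 : r * (r * L) ≤ r * 2 := mul_le_mul_of_nonneg_left h9 hr0.le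
      rw [hρr]; linarith
    have h3 : ρ ≤ 1 / 50 / L := by rw [le_div_iff₀ hL0]; exact h2
    have h4 : (2 * ρ) ^ 2 ≤ 4 * ρ := by nlinarith
    have h5 : 324 / L = 324 * (1 / L) := by ring
    have h6 : 200 / L = 200 * (1 / L) := by ring
    have h7 : 1 / 50 / L = 1 / 50 * (1 / L) := by ring
    have h8 : 0 < 1 / L := by positivity
    rw [← hρr] at h1
    rw [h5]; rw [h6] at hT; rw [h7] at h3
    linarith
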